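/- Let (X, B, μ) be a probability space, T an invertible measure-preserving transformation, A ∈ B with μ(A) > 0, and P ∈ ℤ[x] with P(0) = 0. Then for every ε > 0 and every idempotent ultrafilter p on ℕ, the set {n ∈ ℕ : μ(A ∩ T^{P(n)} A) ≥ μ(A)² − ε} belongs to p; in particular this set is an IP*-set. -/

import Mathlib

open MeasureTheory

attribute [local instance] Ultrafilter.add

section WeakLimits

open Filter Topology

variable {H : Type*} [NormedAddCommGroup H] [InnerProductSpace ℝ H]

theorem Ultrafilter.tendsto_iterated_unique {p : Ultrafilter ℕ} (hp : p + p = p)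
    {F b : ℕ → ℝ} {a c : ℝ} (hF : Tendsto F p (𝓝 a))
    (hb : ∀ᶠ n in p, Tendsto (fun m => F (n + m)) p (𝓝 (b n)))
    (hc : Tendsto b p (𝓝 c)) : c = a := by
  refine (eq_of_forall_dist_le fun ε hε => ?_)
  have h1 : ∀ᶠ n in (p : Filter ℕ), dist (F n) a ≤ ε :=
    hF.eventually (Metric.closedBall_mem_nhds a hε)
  rw [← hp] at h1
  have h2 := (Ultrafilter.eventually_add p p _).1 h1
  refine le_of_tendsto (hc.dist tendsto_const_nhds) ?_
  filter_upwards [h2, hb] with n hn hbn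
  exact le_of_tendsto (hbn.dist tendsto_const_nhds) hn

/-- `Q` is the limit of the operators `A n` along `p` in the weak operator topology. -/
def IsWeakOperatorLimit (p : Ultrafilter ℕ) (A : ℕ → H ≃ₗᵢ[ℝ] H) (Q : H →L[ℝ] H) : Prop :=
  ∀ f g, Tendsto (fun n => inner ℝ (A n f) g) p (𝓝 (inner ℝ (Q f) g))

theorem exists_isWeakOperatorLimit [CompleteSpace H] (p : Ultrafilter ℕ) (A : ℕ → H ≃ₗᵢ[ℝ] H) :
    ∃ Q : H →L[ℝ] H, IsWeakOperatorLimit p A Q := by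
  have hbd : ∀ f g : H, ∀ n, |inner ℝ (A n f) g| ≤ ‖f‖ * ‖g‖ := fun f g n => by
    simpa using abs_real_inner_le_norm (A n f) g
  have hex : ∀ f g : H, ∃ c : ℝ, Tendsto (fun n => inner ℝ (A n f) g) p (𝓝 c) := fun f g => by
    obtain ⟨c, -, hc⟩ := (isCompact_Icc (a := -(‖f‖ * ‖g‖)) (b := ‖f‖ * ‖g‖)).ultrafilter_le_nhds
      (p.map fun n => inner ℝ (A n f) g)
      (le_principal_iff.2 (Filter.mem_map.2 (Filter.univ_mem' fun n => abs_le.1 (hbd f g n))))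
    exact ⟨c, hc⟩
  choose B hB using hex
  let B' : H →ₗ[ℝ] H →ₗ[ℝ] ℝ := LinearMap.mk₂ ℝ B
    (fun f f' g => tendsto_nhds_unique (hB (f + f') g) <| by
      simpa [inner_add_left] using (hB f g).add (hB f' g))
    (fun c f g => tendsto_nhds_unique (hB (c • f) g) <| by
      simpa [real_inner_smul_left] using (hB f g).const_mul c)
    (fun f g g' => tendsto_nhds_unique (hB f (g + g')) <| by
      simpa [inner_add_right] using (hB f g).add (hB f g'))
    (fun c f g => tendsto_nhds_unique (hB f (c • g)) <| by
      simpa [real_inner_smul_right] using (hB f g).const_mul c)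
  let B'' : H →L[ℝ] H →L[ℝ] ℝ := B'.mkContinuous₂ 1 fun f g => by
    rw [one_mul]
    exact le_of_tendsto (hB f g).abs (Eventually.of_forall (hbd f g))
  refine ⟨InnerProductSpace.continuousLinearMapOfBilin (𝕜 := ℝ) B'', fun f g => ?_⟩
  rw [InnerProductSpace.continuousLinearMapOfBilin_apply]
  exact hB f g

namespace IsWeakOperatorLimit

variable {p : Ultrafilter ℕ} {A : ℕ → H ≃ₗᵢ[ℝ] H} {Q : H →L[ℝ] H}

theorem norm_apply_le (hQ : IsWeakOperatorLimit p A Q) (f : H) : ‖Q f‖ ≤ ‖f‖ := by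
  have h : inner ℝ (Q f) (Q f) ≤ ‖f‖ * ‖Q f‖ :=
    le_of_tendsto (hQ f (Q f)) <| Eventually.of_forall fun n => by
      simpa using real_inner_le_norm (A n f) (Q f)
  rw [real_inner_self_eq_norm_mul_norm] at h
  rcases (norm_nonneg (Q f)).eq_or_lt with h0 | h0
  · rw [← h0]; exact norm_nonneg f
  · exact le_of_mul_le_mul_right h h0

theorem comm_apply [CompleteSpace H] (hQ : IsWeakOperatorLimit p A Q) {S : H →L[ℝ] H}
    (hS : ∀ n f, A n (S f) = S (A n f)) (f : H) : Q (S f) = S (Q f) := by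
  refine ext_inner_right ℝ fun g => tendsto_nhds_unique (hQ (S f) g) ?_
  rw [← ContinuousLinearMap.adjoint_inner_right S]
  exact (hQ f _).congr fun n => by rw [hS, ContinuousLinearMap.adjoint_inner_right]

theorem tendsto_of_apply_eq_self (hQ : IsWeakOperatorLimit p A Q) {f : H} (hf : Q f = f) :
    Tendsto (fun n => A n f) p (𝓝 f) := by
  rw [tendsto_iff_norm_sub_tendsto_zero]
  have h : Tendsto (fun n => ‖A n f - f‖ ^ 2) p (𝓝 0) := by
    have h1 := (hQ f f).const_mul 2
    have h2 := (tendsto_const_nhds (x := ‖f‖ ^ 2 + ‖f‖ ^ 2)).sub h1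
    rw [hf, real_inner_self_eq_norm_sq] at h2
    refine (h2.congr fun n => ?_).trans_eq (by ring_nf)
    rw [norm_sub_sq_real, LinearIsometryEquiv.norm_map]
    ring
  simpa using h.sqrt

end IsWeakOperatorLimit

theorem inner_apply_comm_of_idempotent_of_norm_le {Q : H →L[ℝ] H} (hQ : ∀ f, Q (Q f) = Q f)
    (hn : ∀ f, ‖Q f‖ ≤ ‖f‖) (f g : H) : inner ℝ (Q f) g = inner ℝ f (Q g) := by
  have key : ∀ x y : H, Q x = x → Q y = 0 → inner ℝ x y = 0 := by
    intro x y hx hy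
    have h : ∀ t : ℝ, 0 ≤ 2 * (t * inner ℝ x y) + t ^ 2 * ‖y‖ ^ 2 := by
      intro t
      have h1 := hn (x + t • y)
      rw [map_add, map_smul, hx, hy, smul_zero, add_zero] at h1
      have h2 := pow_le_pow_left₀ (norm_nonneg x) h1 2
      rw [norm_add_sq_real, real_inner_smul_right, norm_smul, mul_pow, Real.norm_eq_abs,
        sq_abs] at h2
      linarith
    set a := inner ℝ x y
    have hb : 0 < ‖y‖ ^ 2 + 1 := by positivity
    have h1 := h (-a / (‖y‖ ^ 2 + 1))
    have h2 : 2 * (-a / (‖y‖ ^ 2 + 1) * a) + (-a / (‖y‖ ^ 2 + 1)) ^ 2 * ‖y‖ ^ 2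
        = -(a ^ 2 * ((‖y‖ ^ 2 + 2) / (‖y‖ ^ 2 + 1) ^ 2)) := by
      field_simp
      ring
    rw [h2] at h1
    have h3 : 0 < (‖y‖ ^ 2 + 2) / (‖y‖ ^ 2 + 1) ^ 2 := by positivity
    have h4 : a ^ 2 ≤ 0 := by
      by_contra! h5
      have := mul_pos h5 h3
      linarith
    exact pow_eq_zero_iff two_ne_zero |>.1 (le_antisymm h4 (sq_nonneg a))
  have h1 : inner ℝ (Q f) (g - Q g) = 0 := key _ _ (hQ f) (by simp [hQ])
  have h2 : inner ℝ (Q g) (f - Q f) = 0 := key _ _ (hQ g) (by simp [hQ])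
  rw [inner_sub_right, sub_eq_zero] at h1 h2
  rw [h1, real_inner_comm (Q g) f, h2, real_inner_comm]

/-- A van der Corput lemma along an idempotent ultrafilter. -/
theorem eq_zero_of_tendsto_inner_shift {p : Ultrafilter ℕ} (hp : p + p = p) {x : ℕ → H} {y : H}
    {C : ℝ} (hx : ∀ n, ‖x n‖ ≤ C)
    (hy : Tendsto (fun n => inner ℝ (x n) y) p (𝓝 (inner ℝ y y)))
    (hcor : ∀ᶠ n in p, Tendsto (fun m => inner ℝ (x (n + m)) (x m)) p (𝓝 0)) : y = 0 := by
  by_contra hy0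
  have hpos : 0 < ‖y‖ ^ 2 := by positivity
  set ε := ‖y‖ ^ 2 / 2 with hε
  have hε0 : 0 < ε := by positivity
  have hshift : ∀ {P : ℕ → Prop}, (∀ᶠ n in p, P n) → ∀ᶠ n in p, ∀ᶠ m in p, P (n + m) := by
    intro P h
    rw [← hp] at h
    exact (Ultrafilter.eventually_add p p _).1 h
  have hyx : ∀ᶠ n in p, ε ≤ inner ℝ (x n) y := by
    refine (hy.eventually (lt_mem_nhds (a := ε) ?_)).mono fun n hn => hn.le
    rw [real_inner_self_eq_norm_sq]
    linarith
  have step : ∀ k : ℕ, ∃ z : ℕ → H,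
      (∀ᶠ n in p, Tendsto (fun m => inner ℝ (z (n + m)) (x m)) p (𝓝 0)) ∧
      (∀ᶠ m in p, k * ε ≤ inner ℝ (z m) y) ∧ ∀ᶠ m in p, ‖z m‖ ^ 2 ≤ k * (C ^ 2 + 1) := by
    intro k
    induction k with
    | zero => exact ⟨0, by simp⟩
    | succ k ih =>
      obtain ⟨z, h1, h2, h3⟩ := ih
      obtain ⟨n, hn1, hn1', hn2, hn3⟩ :=
        (h1.and ((hshift h1).and ((hshift h2).and (hshift h3)))).exists
      refine ⟨fun m => x m + z (n + m), ?_, ?_, ?_⟩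
      · filter_upwards [hcor, hn1'] with i hi hi'
        simpa [inner_add_left, add_assoc] using hi.add hi'
      · filter_upwards [hyx, hn2] with m hm hm'
        rw [inner_add_left]
        push_cast
        linarith
      · filter_upwards [hn1.eventually (gt_mem_nhds (show (0 : ℝ) < 1 / 2 by norm_num)), hn3]
          with m hm hm'
        rw [norm_add_sq_real, real_inner_comm]
        have := pow_le_pow_left₀ (norm_nonneg _) (hx m) 2
        push_cast
        linarith
  obtain ⟨k, hk⟩ := exists_nat_gt ((C ^ 2 + 1) * ‖y‖ ^ 2 / ε ^ 2)
  have hk0 : (0 : ℝ) < k := lt_of_le_of_lt (by positivity) hk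
  obtain ⟨z, -, h2, h3⟩ := step k
  obtain ⟨m, hm2, hm3⟩ := (h2.and h3).exists
  have h4 : k * ε ≤ ‖z m‖ * ‖y‖ := hm2.trans (real_inner_le_norm _ _)
  have h5 := pow_le_pow_left₀ (by positivity) h4 2
  have h6 : (k * ε) ^ 2 ≤ k * (C ^ 2 + 1) * ‖y‖ ^ 2 := by
    rw [mul_pow ‖z m‖] at h5
    exact h5.trans (mul_le_mul_of_nonneg_right hm3 (by positivity))
  rw [div_lt_iff₀ (by positivity)] at hk
  nlinarith [mul_lt_mul_of_pos_left hk hk0]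

end WeakLimits

section PolynomialPowers

open Filter Topology Polynomial

variable {H : Type*} [NormedAddCommGroup H] [InnerProductSpace ℝ H]

/-- The polynomial `q(X + n) - q(X) - q(n)`. -/
noncomputable def Polynomial.polarization (q : ℤ[X]) (n : ℤ) : ℤ[X] :=
  taylor n q - q - C (q.eval n)

theorem Polynomial.eval_polarization (q : ℤ[X]) (n m : ℤ) :
    (q.polarization n).eval m = q.eval (n + m) - q.eval m - q.eval n := by
  simp [polarization, taylor_eval, add_comm]

theorem Polynomial.polarization_mem_degreeLT {d : ℕ} {q : ℤ[X]} (hq : q ∈ degreeLT ℤ (d + 1))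
    (hq0 : q.eval 0 = 0) (n : ℤ) : q.polarization n ∈ degreeLT ℤ d := by
  by_cases h0 : q = 0
  · simp [h0, polarization]
  have hq1 : q.degree ≤ d := by
    rw [mem_degreeLT] at hq
    exact degree_le_of_natDegree_le (Nat.lt_succ_iff.1 ((natDegree_lt_iff_degree_lt h0).2 hq))
  have hq2 : 0 < q.degree := by
    by_contra! h
    rw [eq_C_of_degree_le_zero h] at hq0 h0
    simp at hq0
    simp [hq0] at h0
  rw [mem_degreeLT, polarization]
  have h : (taylor n q - q).degree < (taylor n q).degree :=
    degree_sub_lt_left (degree_taylor q n) (by simpa using h0) (leadingCoeff_taylor n q)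
  rw [degree_taylor] at h
  exact (degree_sub_le _ _).trans_lt
    (max_lt (h.trans_le hq1) (degree_C_le.trans_lt (hq2.trans_le hq1)))

theorem LinearIsometryEquiv.zpow_add_apply (U : H ≃ₗᵢ[ℝ] H) (a b : ℤ) (f : H) :
    (U ^ (a + b)) f = (U ^ a) ((U ^ b) f) := by
  rw [zpow_add]; rfl

theorem LinearIsometryEquiv.inner_zpow_left (U : H ≃ₗᵢ[ℝ] H) (a : ℤ) (f g : H) :
    inner ℝ ((U ^ a) f) g = inner ℝ f ((U ^ (-a)) g) := by
  rw [← (U ^ (-a)).inner_map_map, ← zpow_add_apply]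
  simp

/-- The polynomials in `L` along which `f` is a rigid vector for `U`. -/
noncomputable def rigiditySubmodule (U : H ≃ₗᵢ[ℝ] H) (p : Ultrafilter ℕ) (L : Submodule ℤ ℤ[X]) (f : H) :
    Submodule ℤ L :=
  AddSubgroup.toIntSubmodule
    { carrier := {r | Tendsto (fun m : ℕ => (U ^ ((r : ℤ[X]).eval (m : ℤ))) f) p (𝓝 f)}
      zero_mem' := by simp
      add_mem' := by
        intro r s hr hs
        rw [Set.mem_ofPred_eq, tendsto_iff_norm_sub_tendsto_zero] at *
        refine squeeze_zero (fun _ => norm_nonneg _) (fun m => ?_) (by simpa using hs.add hr)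
        have : (U ^ (((r + s : L) : ℤ[X]).eval (m : ℤ))) f - f
            = (U ^ ((r : ℤ[X]).eval (m : ℤ))) ((U ^ ((s : ℤ[X]).eval (m : ℤ))) f - f)
              + ((U ^ ((r : ℤ[X]).eval (m : ℤ))) f - f) := by
          simp [LinearIsometryEquiv.zpow_add_apply]
        rw [this]
        exact (norm_add_le _ _).trans_eq (by rw [LinearIsometryEquiv.norm_map])
      neg_mem' := by
        intro r hr
        rw [Set.mem_ofPred_eq, tendsto_iff_norm_sub_tendsto_zero] at *
        refine hr.congr fun m => ?_
        rw [← (U ^ ((r : ℤ[X]).eval (m : ℤ))).norm_map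
          ((U ^ (((-r : L) : ℤ[X]).eval (m : ℤ))) f - f), map_sub,
          ← LinearIsometryEquiv.zpow_add_apply, norm_sub_rev]
        simp }

theorem mem_rigiditySubmodule {U : H ≃ₗᵢ[ℝ] H} {p : Ultrafilter ℕ} {L : Submodule ℤ ℤ[X]} {f : H}
    {r : L} : r ∈ rigiditySubmodule U p L f ↔
      Tendsto (fun m : ℕ => (U ^ ((r : ℤ[X]).eval (m : ℤ))) f) p (𝓝 f) :=
  Iff.rfl

theorem apply_apply_eq_of_eventually_rigid {U : H ≃ₗᵢ[ℝ] H} {p : Ultrafilter ℕ} (hp : p + p = p)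
    {q : ℤ[X]} {Q : H →L[ℝ] H}
    (hQ : IsWeakOperatorLimit p (fun n => U ^ q.eval (n : ℤ)) Q) {f : H}
    (hf : ∀ᶠ n : ℕ in p,
      Tendsto (fun m : ℕ => (U ^ (q.polarization n).eval (m : ℤ)) f) p (𝓝 f)) :
    Q (Q f) = Q f := by
  refine ext_inner_right ℝ fun g => Ultrafilter.tendsto_iterated_unique hp (hQ f g) ?_ (hQ (Q f) g)
  filter_upwards [hf] with n hn
  rw [LinearIsometryEquiv.inner_zpow_left]
  set g' := (U ^ (-q.eval (n : ℤ))) g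
  have h1 : Tendsto (fun m : ℕ => inner ℝ ((U ^ q.eval (m : ℤ))
      ((U ^ (q.polarization n).eval (m : ℤ)) f - f)) g') p (𝓝 0) := by
    rw [tendsto_iff_norm_sub_tendsto_zero] at hn
    refine squeeze_zero_norm (fun m => ?_) (by simpa using hn.mul_const ‖g'‖)
    simpa only [LinearIsometryEquiv.norm_map] using norm_inner_le_norm (𝕜 := ℝ) ((U ^ q.eval (m : ℤ))
      ((U ^ (q.polarization n).eval (m : ℤ)) f - f)) g'
  refine (h1.add (hQ f g')).congr' (Eventually.of_forall fun m => ?_) |>.trans_eq (by rw [zero_add])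
  rw [map_sub, inner_sub_left, sub_add_cancel, ← LinearIsometryEquiv.zpow_add_apply,
    ← LinearIsometryEquiv.inner_zpow_left, ← LinearIsometryEquiv.zpow_add_apply,
    eval_polarization]
  congr 3
  push_cast
  ring_nf

theorem apply_eq_zero_of_eventually_weakly_mixing {U : H ≃ₗᵢ[ℝ] H} {p : Ultrafilter ℕ}
    (hp : p + p = p) {q : ℤ[X]} {Q : H →L[ℝ] H}
    (hQ : IsWeakOperatorLimit p (fun n => U ^ q.eval (n : ℤ)) Q) {f : H}
    (hf : ∀ᶠ n : ℕ in p, ∀ g, Tendsto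
      (fun m : ℕ => inner ℝ ((U ^ (q.polarization n).eval (m : ℤ)) f) g) p (𝓝 0)) :
    Q f = 0 := by
  refine eq_zero_of_tendsto_inner_shift hp (x := fun n => (U ^ q.eval (n : ℤ)) f) (C := ‖f‖)
    (fun n => by simp) (hQ f _) ?_
  filter_upwards [hf] with n hn
  refine (hn ((U ^ (-q.eval (n : ℤ))) f)).congr fun m => ?_
  rw [← LinearIsometryEquiv.inner_zpow_left, ← LinearIsometryEquiv.zpow_add_apply,
    ← (U ^ q.eval (m : ℤ)).inner_map_map, ← LinearIsometryEquiv.zpow_add_apply, eval_polarization]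
  congr 3
  push_cast
  ring_nf

theorem IsWeakOperatorLimit.idempotent [CompleteSpace H] (U : H ≃ₗᵢ[ℝ] H) {p : Ultrafilter ℕ}
    (hp : p + p = p) (d : ℕ) : ∀ q ∈ degreeLT ℤ d, q.eval 0 = 0 → ∀ Q : H →L[ℝ] H,
      IsWeakOperatorLimit p (fun n => U ^ q.eval (n : ℤ)) Q → ∀ f, Q (Q f) = Q f := by
  induction d with
  | zero =>
    intro q hq _ Q hQ f
    obtain rfl : q = 0 := by simpa [mem_degreeLT] using hq
    have h : ∀ f, Q f = f := fun f => ext_inner_right ℝ fun g =>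
      tendsto_nhds_unique (hQ f g) (by simp)
    rw [h, h]
  | succ d ih =>
    intro q hq hq0 Q hQ
    let L : Submodule ℤ ℤ[X] := degreeLT ℤ d ⊓ LinearMap.ker (leval (0 : ℤ))
    have hL : ∀ n : ℤ, q.polarization n ∈ L := fun n =>
      ⟨polarization_mem_degreeLT hq hq0 n, by simp [leval, eval_polarization, hq0]⟩
    have : IsNoetherian ℤ (degreeLT ℤ d) := isNoetherian_of_linearEquiv (degreeLTEquiv ℤ d).symm
    have : IsNoetherian ℤ L := isNoetherian_of_le (inf_le_left : L ≤ degreeLT ℤ d)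
    choose P hP using fun r : L =>
      exists_isWeakOperatorLimit p (fun n => U ^ (r : ℤ[X]).eval (n : ℤ))
    have hPP : ∀ r f, P r (P r f) = P r f := fun r => ih r r.2.1 (by simpa using r.2.2) _ (hP r)
    have hPU : ∀ r (a : ℤ) f, P r ((U ^ a) f) = (U ^ a) (P r f) := fun r a f =>
      (hP r).comm_apply (S := ((U ^ a).toContinuousLinearEquiv : H →L[ℝ] H)) (fun n f => by
        change (U ^ _) ((U ^ a) f) = (U ^ a) ((U ^ _) f)
        rw [← LinearIsometryEquiv.zpow_add_apply, ← LinearIsometryEquiv.zpow_add_apply,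
          add_comm]) f
    have hQP : ∀ r f, Q (P r f) = P r (Q f) := fun r =>
      hQ.comm_apply fun n f => (hPU r _ f).symm
    let G : Submodule ℝ H := LinearMap.ker ((Q.comp Q - Q : H →L[ℝ] H) : H →ₗ[ℝ] H)
    have hG : ∀ f, f ∈ G ↔ Q (Q f) = Q f := fun f => by simp [G, sub_eq_zero]
    have : CompleteSpace G := (Q.comp Q - Q).isClosed_ker.completeSpace_coe
    suffices h : Gᗮ = ⊥ by
      intro f
      rw [← hG, Submodule.orthogonal_eq_bot_iff.1 h]
      trivial
    by_contra hne
    obtain ⟨f₀, hf₀, hf₀'⟩ := Submodule.exists_mem_ne_zero_of_ne_bot hne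
    obtain ⟨-, ⟨f, hf, hf0, rfl⟩, hmax⟩ := (wellFounded_gt (α := Submodule ℤ L)).has_min
      {S | ∃ f ∈ Gᗮ, f ≠ 0 ∧ rigiditySubmodule U p L f = S} ⟨_, f₀, hf₀, hf₀', rfl⟩
    have hPf : ∀ r : L, r ∉ rigiditySubmodule U p L f → P r f = 0 := by
      intro r hr
      by_contra hr0
      refine hmax _ ⟨P r f, ?_, hr0, rfl⟩ (lt_of_le_of_ne (fun s hs => ?_) fun h => hr ?_)
      · rw [Submodule.mem_orthogonal] at hf ⊢
        intro g hg
        rw [← inner_apply_comm_of_idempotent_of_norm_le (hPP r) (hP r).norm_apply_le]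
        apply hf
        rw [hG] at hg ⊢
        rw [hQP, hQP, hg]
      · rw [mem_rigiditySubmodule] at hs ⊢
        simp only [← hPU]
        exact ((P r).continuous.tendsto f).comp hs
      · rw [h]
        exact (hP r).tendsto_of_apply_eq_self (hPP r f)
    have hfG : f ∈ G := by
      rw [hG]
      by_cases hcase : ∀ᶠ n : ℕ in p, (⟨_, hL n⟩ : L) ∈ rigiditySubmodule U p L f
      · exact apply_apply_eq_of_eventually_rigid hp hQ hcase
      · have hz : Q f = 0 := apply_eq_zero_of_eventually_weakly_mixing hp hQ <| by
          filter_upwards [Ultrafilter.eventually_not.2 hcase] with n hn g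
          simpa [hPf _ hn] using hP ⟨_, hL n⟩ f g
        rw [hz, map_zero]
    exact hf0 (inner_self_eq_zero.1 (hf f hfG))

end PolynomialPowers

section Koopman

/-- The Koopman operator `f ↦ f ∘ T⁻¹` on real `L²`. -/
noncomputable def koopman {X : Type*} [MeasurableSpace X] {μ : Measure X} (T : Equiv.Perm X)
    (hT : MeasurePreserving T μ μ) (hT' : MeasurePreserving T.symm μ μ) :
    Lp ℝ 2 μ ≃ₗᵢ[ℝ] Lp ℝ 2 μ where
  toLinearEquiv := LinearEquiv.ofLinearMap (Lp.compMeasurePreservingₗ ℝ T.symm hT')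
    (Lp.compMeasurePreservingₗ ℝ T hT)
    (by
      ext1 f
      have := Lp.compMeasurePreserving_comp_apply f hT hT'
      simp only [Equiv.self_comp_symm] at this
      exact this.symm.trans (Lp.compMeasurePreserving_id_apply f))
    (by
      ext1 f
      have := Lp.compMeasurePreserving_comp_apply f hT' hT
      simp only [Equiv.symm_comp_self] at this
      exact this.symm.trans (Lp.compMeasurePreserving_id_apply f))
  norm_map' f := Lp.norm_compMeasurePreserving f hT'

variable {X : Type*} [MeasurableSpace X] {μ : Measure X} [IsFiniteMeasure μ] {T : Equiv.Perm X}

theorem measurableSet_zpow_image (hT : Measurable T) (hT' : Measurable T.symm) (k : ℤ)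
    {A : Set X} (hA : MeasurableSet A) : MeasurableSet ((T ^ k) '' A) := by
  induction k with
  | zero => simpa using hA
  | succ k ih =>
    rw [add_comm, zpow_add, zpow_one, Equiv.Perm.coe_mul, Set.image_comp,
      Equiv.image_eq_preimage_symm]
    exact hT' ih
  | pred k ih =>
    rw [sub_eq_neg_add, zpow_add, zpow_neg_one, Equiv.Perm.coe_mul, Set.image_comp,
      Equiv.image_eq_preimage_symm]
    exact hT ih

theorem koopman_zpow_indicator (hT : MeasurePreserving T μ μ)
    (hT' : MeasurePreserving T.symm μ μ) (k : ℤ) {A : Set X} (hA : MeasurableSet A) :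
    (koopman T hT hT' ^ k) (indicatorConstLp 2 hA (measure_ne_top μ A) (1 : ℝ)) =
      indicatorConstLp 2 (measurableSet_zpow_image hT.measurable hT'.measurable k hA)
        (measure_ne_top μ _) (1 : ℝ) := by
  have hcongr : ∀ {S S' : Set X} (hS : MeasurableSet S) (hS' : MeasurableSet S'), S = S' →
      indicatorConstLp 2 hS (measure_ne_top μ S) (1 : ℝ) =
        indicatorConstLp 2 hS' (measure_ne_top μ S') (1 : ℝ) := by
    rintro S _ hS hS' rfl
    rfl
  induction k with
  | zero => exact hcongr hA _ (by simp)
  | succ k ih =>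
    rw [add_comm, LinearIsometryEquiv.zpow_add_apply, ih, zpow_one]
    refine (Lp.indicatorConstLp_compMeasurePreserving _ _ _ hT').trans (hcongr _ _ ?_)
    rw [zpow_add, zpow_one, Equiv.Perm.coe_mul, Set.image_comp,
      Equiv.image_eq_preimage_symm T]
  | pred k ih =>
    rw [sub_eq_neg_add, LinearIsometryEquiv.zpow_add_apply, ih, zpow_neg_one]
    refine (Lp.indicatorConstLp_compMeasurePreserving _ _ _ hT).trans (hcongr _ _ ?_)
    rw [zpow_add, zpow_neg_one, Equiv.Perm.coe_mul, Set.image_comp,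
      Equiv.image_eq_preimage_symm T⁻¹]
    rfl

end Koopman

/-- polynomial Khintchine along idempotent ultrafilters. Let `(X,B,μ)`
be a probability space, `T` an invertible measure-preserving transformation, `A` measurable
with `μ(A) > 0`, and `P ∈ ℤ[x]` with `P(0) = 0`. Then for every `ε > 0` and every
idempotent ultrafilter `p` on `ℕ`, the set
`{n : μ(A ∩ T^{P(n)} A) ≥ μ(A)² − ε}` belongs to `p` (in particular, it is an IP*-set). -/
theorem khintchine_poly_idempotent {X : Type*} [MeasurableSpace X]
    (μ : Measure X) [IsProbabilityMeasure μ]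
    (T : Equiv.Perm X) (hT : MeasurePreserving T μ μ) (hT' : MeasurePreserving T.symm μ μ)
    (A : Set X) (hA : MeasurableSet A) (hApos : 0 < μ A)
    (P : Polynomial ℤ) (hP0 : P.eval 0 = 0)
    (ε : ℝ) (hε : 0 < ε)
    (p : Ultrafilter ℕ) (hp : p + p = p) :
    {n : ℕ | (μ A).toReal ^ 2 - ε ≤ (μ (A ∩ (T ^ (P.eval (n : ℤ))) '' A)).toReal} ∈ p := by
  let U := koopman T hT hT'
  obtain ⟨Q, hQ⟩ := exists_isWeakOperatorLimit p fun n => U ^ P.eval (n : ℤ)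
  have hidem := IsWeakOperatorLimit.idempotent U hp (P.natDegree + 1) P
    (Polynomial.mem_degreeLT.2 (Polynomial.degree_lt_iff_coeff_zero _ _ |>.2 fun m hm =>
      Polynomial.coeff_eq_zero_of_natDegree_lt hm)) hP0 Q hQ
  have hsymm := inner_apply_comm_of_idempotent_of_norm_le hidem hQ.norm_apply_le
  let f : Lp ℝ 2 μ := indicatorConstLp 2 hA (measure_ne_top μ A) 1
  let e : Lp ℝ 2 μ := indicatorConstLp 2 MeasurableSet.univ (measure_ne_top μ _) 1
  have hfe : inner ℝ f e = μ.real A := by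
    simpa using L2.real_inner_indicatorConstLp_one_indicatorConstLp_one hA MeasurableSet.univ
  have hee : ‖e‖ = 1 := by
    have : inner ℝ e e = 1 := by
      rw [L2.real_inner_indicatorConstLp_one_indicatorConstLp_one]
      simp
    rw [real_inner_self_eq_norm_sq] at this
    nlinarith [norm_nonneg e]
  have hUe : ∀ k : ℤ, (U ^ k) e = e := fun k => by
    refine (koopman_zpow_indicator hT hT' k MeasurableSet.univ).trans ?_
    simp only [Set.image_univ, Equiv.range_eq_univ]
    rfl
  have hQe : Q e = e := ext_inner_right ℝ fun g =>
    tendsto_nhds_unique (hQ e g) (by simpa only [hUe] using tendsto_const_nhds)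
  have hlim : μ.real A ^ 2 ≤ inner ℝ (Q f) f := by
    have h1 : μ.real A ≤ ‖Q f‖ := by
      rw [← hfe, ← hQe, ← hsymm]
      simpa [hee] using real_inner_le_norm (Q f) e
    rw [← hidem, hsymm, real_inner_self_eq_norm_sq]
    exact pow_le_pow_left₀ measureReal_nonneg h1 2
  filter_upwards [(hQ f f).eventually (lt_mem_nhds (a := μ.real A ^ 2 - ε) (by linarith))] with n hn
  have hin : inner ℝ ((U ^ P.eval (n : ℤ)) f) f = μ.real (A ∩ (T ^ P.eval (n : ℤ)) '' A) := by
    rw [koopman_zpow_indicator hT hT' _ hA, Set.inter_comm]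
    exact L2.real_inner_indicatorConstLp_one_indicatorConstLp_one _ hA
  exact (hn.trans_eq hin).le
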